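/- arXiv:2102.09591 — 5 statements merged into one kernel-verified Lean document; each statement's English description precedes it below -/
import Mathlib

section
/- If κ is a subtle cardinal, then the collection NSub_κ of non-subtle subsets of κ is a normal ideal on κ. -/
namespace LCI


/-- `κ` is (the initial ordinal of) a regular uncountable cardinal. -/
def RegUncountable (kappa : Ordinal.{0}) : Prop :=
  Ordinal.omega0 < kappa ∧ kappa.cof.ord = kappa

/-- `C` is a club (closed unbounded) subset of the ordinal `κ`. -/
def IsClubIn (C : Set Ordinal.{0}) (kappa : Ordinal.{0}) : Prop :=
  C ⊆ Set.Iio kappa ∧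
  (∀ alpha < kappa, ∃ beta ∈ C, alpha < beta) ∧
  ∀ beta < kappa, beta ≠ 0 →
    (∀ gamma < beta, ∃ delta ∈ C, gamma < delta ∧ delta < beta) → beta ∈ C

/-- `S` is a stationary subset of the ordinal `κ`. -/
def IsStationaryIn (S : Set Ordinal.{0}) (kappa : Ordinal.{0}) : Prop :=
  S ⊆ Set.Iio kappa ∧ ∀ C, IsClubIn C kappa → (S ∩ C).Nonempty

/-- `H` is homogeneous for the list `L` (where `L α ⊆ α` on the relevant domain):
whenever `α < β` are both in `H`, `L α = L β ∩ α`. -/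
def Homog (L : Ordinal.{0} → Set Ordinal.{0}) (H : Set Ordinal.{0}) : Prop :=
  ∀ alpha ∈ H, ∀ beta ∈ H, alpha < beta → L alpha = L beta ∩ Set.Iio alpha

/-- `S ⊆ κ` is a subtle subset of `κ`: for every `S`-list `L` (i.e. `L α ⊆ α` for
`α ∈ S`) and every club `C ⊆ κ` there are `α < β` in `S ∩ C` with `L α = L β ∩ α`. -/
def IsSubtleIn (S : Set Ordinal.{0}) (kappa : Ordinal.{0}) : Prop :=
  S ⊆ Set.Iio kappa ∧
  ∀ L : Ordinal.{0} → Set Ordinal.{0}, (∀ alpha ∈ S, L alpha ⊆ Set.Iio alpha) →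
    ∀ C, IsClubIn C kappa →
      ∃ alpha ∈ S ∩ C, ∃ beta ∈ S ∩ C, alpha < beta ∧ L alpha = L beta ∩ Set.Iio alpha

/-- `I` is an ideal on the ordinal `κ`: a collection of subsets of `κ` containing `∅`,
closed under subsets and finite unions. -/
def IsIdealOn (kappa : Ordinal.{0}) (I : Set (Set Ordinal.{0})) : Prop :=
  (∀ X ∈ I, X ⊆ Set.Iio kappa) ∧ (∅ ∈ I) ∧
  (∀ X ∈ I, ∀ Y, Y ⊆ X → Y ∈ I) ∧
  (∀ X ∈ I, ∀ Y ∈ I, X ∪ Y ∈ I)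

/-- The diagonal union `∇_{α<κ} X α = {β < κ : β ∈ ⋃_{α<β} X α}`. -/
def diagUnion (kappa : Ordinal.{0}) (X : Ordinal.{0} → Set Ordinal.{0}) : Set Ordinal.{0} :=
  {beta | beta < kappa ∧ ∃ alpha < beta, beta ∈ X alpha}

/-- `I` is a normal ideal on `κ`: an ideal closed under diagonal unions. -/
def IsNormalIdealOn (kappa : Ordinal.{0}) (I : Set (Set Ordinal.{0})) : Prop :=
  IsIdealOn kappa I ∧
  ∀ X : Ordinal.{0} → Set Ordinal.{0}, (∀ alpha < kappa, X alpha ∈ I) → diagUnion kappa X ∈ I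

/-- The subtle ideal on `κ`: the collection of non-subtle subsets of `κ`. -/
def NSub (kappa : Ordinal.{0}) : Set (Set Ordinal.{0}) :=
  {X | X ⊆ Set.Iio kappa ∧ ¬ IsSubtleIn X kappa}

open Order

theorem RegUncountable.aleph0_lt_cof {kappa : Ordinal.{0}} (h : RegUncountable kappa) :
    Cardinal.aleph0 < kappa.cof := by
  rw [← Cardinal.ord_lt_ord, Cardinal.ord_aleph0, h.2]
  exact h.1

theorem RegUncountable.isSuccLimit {kappa : Ordinal.{0}} (h : RegUncountable kappa) :
    IsSuccLimit kappa :=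
  h.2 ▸ Cardinal.isSuccLimit_ord h.aleph0_lt_cof.le

theorem RegUncountable.iSup_lt {kappa alpha : Ordinal.{0}} (h : RegUncountable kappa)
    (ha : alpha < kappa) (g : Set.Iio alpha → Ordinal.{0}) (hg : ∀ i, g i < kappa) :
    ⨆ i, g i < kappa := by
  refine Ordinal.lift_iSup_lt_of_lt_cof ?_ hg
  rw [← Ordinal.lift_cof, Cardinal.mk_Iio_ordinal, Cardinal.lift_lift, Cardinal.lift_lt,
    ← Cardinal.lt_ord, h.2]
  exact ha

theorem isClubIn_Iio {kappa : Ordinal.{0}} (h : IsSuccLimit kappa) :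
    IsClubIn (Set.Iio kappa) kappa :=
  ⟨subset_rfl, fun alpha ha => ⟨succ alpha, h.succ_lt ha, lt_succ alpha⟩, fun _ hb _ _ => hb⟩

/-- The set of limit ordinals in the diagonal intersection of the sets `C alpha`. -/
def limitDiagInter (kappa : Ordinal.{0}) (C : Ordinal.{0} → Set Ordinal.{0}) :
    Set Ordinal.{0} :=
  {beta | beta < kappa ∧ IsSuccLimit beta ∧ ∀ alpha < beta, beta ∈ C alpha}

theorem exists_step {kappa : Ordinal.{0}} (h : RegUncountable kappa)
    {C : Ordinal.{0} → Set Ordinal.{0}} (hC : ∀ alpha < kappa, IsClubIn (C alpha) kappa)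
    {alpha : Ordinal.{0}} (ha : alpha < kappa) :
    ∃ beta < kappa, alpha < beta ∧ ∀ gamma < alpha, ∃ delta ∈ C gamma, alpha < delta ∧
      delta < beta := by
  choose g hgC hg using fun i : Set.Iio alpha => (hC i (i.2.trans ha)).2.1 alpha ha
  have hlt : ⨆ i, succ (g i) < kappa :=
    h.iSup_lt ha _ fun i => h.isSuccLimit.succ_lt ((hC i (i.2.trans ha)).1 (hgC i))
  refine ⟨max (⨆ i, succ (g i)) (succ alpha), max_lt hlt (h.isSuccLimit.succ_lt ha),
    lt_max_of_lt_right (lt_succ alpha), fun gamma hgamma =>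
      ⟨g ⟨gamma, hgamma⟩, hgC ⟨gamma, hgamma⟩, hg _, lt_max_of_lt_left ?_⟩⟩
  exact (lt_succ _).trans_le (Ordinal.le_iSup (fun i => succ (g i)) ⟨gamma, hgamma⟩)

theorem isSuccLimit_of_forall_exists_between {beta : Ordinal.{0}} (h0 : beta ≠ 0)
    (h : ∀ gamma < beta, ∃ delta, gamma < delta ∧ delta < beta) : IsSuccLimit beta := by
  rw [Ordinal.isSuccLimit_iff, isSuccPrelimit_iff_succ_lt]
  refine ⟨h0, fun gamma hgamma => ?_⟩
  obtain ⟨delta, h1, h2⟩ := h gamma hgamma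
  exact (succ_le_of_lt h1).trans_lt h2

theorem isClubIn_limitDiagInter {kappa : Ordinal.{0}} (h : RegUncountable kappa)
    {C : Ordinal.{0} → Set Ordinal.{0}} (hC : ∀ alpha < kappa, IsClubIn (C alpha) kappa) :
    IsClubIn (limitDiagInter kappa C) kappa := by
  refine ⟨fun _ hb => hb.1, fun alpha ha => ?_, fun beta hb h0 hlim => ?_⟩
  · choose f hf_lt hf_gt hf using fun a : Set.Iio kappa => exists_step h hC a.2
    let s : ℕ → Set.Iio kappa := fun n => (fun a => ⟨f a, hf_lt a⟩)^[n] ⟨alpha, ha⟩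
    have hs (n : ℕ) : (s (n + 1) : Ordinal.{0}) = f (s n) := by
      simp only [s, Function.iterate_succ_apply']
    have hs_lt (n : ℕ) : (s n : Ordinal.{0}) < s (n + 1) := hs n ▸ hf_gt (s n)
    have hmono : StrictMono fun n => (s n : Ordinal.{0}) := strictMono_nat_of_lt_succ hs_lt
    have hle (n : ℕ) : (s n : Ordinal.{0}) ≤ ⨆ n, (s n : Ordinal.{0}) :=
      Ordinal.le_iSup (fun n => (s n : Ordinal.{0})) n
    have hlt (n : ℕ) : (s n : Ordinal.{0}) < ⨆ n, (s n : Ordinal.{0}) :=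
      (hs_lt n).trans_le (hle (n + 1))
    have hsup : ⨆ n, (s n : Ordinal.{0}) < kappa :=
      Ordinal.iSup_lt_of_lt_cof (by simpa using h.aleph0_lt_cof) fun n => (s n).2
    have hex {gamma : Ordinal.{0}} (hg : gamma < ⨆ n, (s n : Ordinal.{0})) :
        ∃ n, gamma < s n := Ordinal.lt_iSup_iff.1 hg
    refine ⟨⨆ n, (s n : Ordinal.{0}), ⟨hsup, ?_, fun gamma hgamma => ?_⟩, hlt 0⟩
    · refine isSuccLimit_of_forall_exists_between (hlt 0).ne_bot fun gamma hgamma => ?_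
      obtain ⟨n, hn⟩ := hex hgamma
      exact ⟨s n, hn, hlt n⟩
    · refine (hC gamma (hgamma.trans hsup)).2.2 _ hsup (hlt 0).ne_bot fun eps heps => ?_
      obtain ⟨n, hn⟩ := hex (max_lt hgamma heps)
      obtain ⟨delta, hd, hd1, hd2⟩ := hf (s n) gamma ((le_max_left _ _).trans_lt hn)
      exact ⟨delta, hd, ((le_max_right _ _).trans_lt hn).trans hd1,
        hd2.trans_le (hs n ▸ hle (n + 1))⟩
  · refine ⟨hb, isSuccLimit_of_forall_exists_between h0 fun gamma hgamma => ?_,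
      fun gamma hgamma => (hC gamma (hgamma.trans hb)).2.2 _ hb h0 fun eps heps => ?_⟩
    · obtain ⟨delta, -, hd⟩ := hlim gamma hgamma
      exact ⟨delta, hd⟩
    · obtain ⟨delta, hd, hd1, hd2⟩ := hlim _ (max_lt hgamma heps)
      exact ⟨delta, hd.2.2 gamma ((le_max_left _ _).trans_lt hd1),
        (le_max_right _ _).trans_lt hd1, hd2⟩

theorem two_mul_lt_of_isSuccLimit {xi beta : Ordinal.{0}} (hb : IsSuccLimit beta)
    (hxi : xi < beta) : 2 * xi < beta := by
  have h2 : 2 * beta = beta := Ordinal.mul_omega0_dvd two_pos (Ordinal.natCast_lt_omega0 2)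
    (Ordinal.isSuccPrelimit_iff_omega0_dvd.1 hb.isSuccPrelimit)
  calc 2 * xi < 2 * beta := mul_lt_mul_of_pos_left hxi two_pos
    _ = beta := h2

theorem two_mul_inj {a b : Ordinal.{0}} : 2 * a = 2 * b ↔ a = b :=
  mul_right_inj' two_ne_zero

theorem two_mul_add_one_ne_two_mul (a b : Ordinal.{0}) : 2 * a + 1 ≠ 2 * b := by
  intro h
  have h' := congrArg (· % 2) h
  simp only [Ordinal.mul_add_mod_self, Ordinal.mul_mod] at h'
  rw [Ordinal.mod_eq_of_lt one_lt_two] at h'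
  exact one_ne_zero h'

/-- A code for the pair of an ordinal `gamma` and a set `A` of ordinals as a set of ordinals. -/
def pairCode (gamma : Ordinal.{0}) (A : Set Ordinal.{0}) : Set Ordinal.{0} :=
  insert (2 * gamma + 1) ((2 * ·) '' A)

theorem two_mul_add_one_mem_pairCode {gamma delta : Ordinal.{0}} {A : Set Ordinal.{0}} :
    2 * delta + 1 ∈ pairCode gamma A ↔ delta = gamma := by
  simp [pairCode, fun x => (two_mul_add_one_ne_two_mul delta x).symm]

theorem two_mul_mem_pairCode {gamma xi : Ordinal.{0}} {A : Set Ordinal.{0}} :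
    2 * xi ∈ pairCode gamma A ↔ xi ∈ A := by
  simp [pairCode, (two_mul_add_one_ne_two_mul gamma xi).symm]

theorem pairCode_subset_Iio {gamma beta : Ordinal.{0}} {A : Set Ordinal.{0}}
    (hb : IsSuccLimit beta) (hgamma : gamma < beta) (hA : A ⊆ Set.Iio beta) :
    pairCode gamma A ⊆ Set.Iio beta := by
  rintro _ (rfl | ⟨xi, hxi, rfl⟩)
  · exact hb.succ_lt (two_mul_lt_of_isSuccLimit hb hgamma)
  · exact two_mul_lt_of_isSuccLimit hb (hA hxi)

theorem eq_and_eq_of_pairCode_eq {gamma delta alpha : Ordinal.{0}} {A B : Set Ordinal.{0}}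
    (ha : IsSuccLimit alpha) (hA : A ⊆ Set.Iio alpha)
    (h : pairCode gamma A = pairCode delta B ∩ Set.Iio alpha) :
    gamma = delta ∧ A = B ∩ Set.Iio alpha := by
  have hmem (x : Ordinal.{0}) : x ∈ pairCode gamma A ↔ x ∈ pairCode delta B ∧ x < alpha := by
    rw [h]; rfl
  refine ⟨two_mul_add_one_mem_pairCode.1
    ((hmem _).1 (two_mul_add_one_mem_pairCode.2 rfl)).1, ?_⟩
  ext xi
  have hxi := hmem (2 * xi)
  rw [two_mul_mem_pairCode, two_mul_mem_pairCode] at hxi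
  exact ⟨fun hx => ⟨(hxi.1 hx).1, hA hx⟩,
    fun hx => hxi.2 ⟨hx.1, two_mul_lt_of_isSuccLimit ha hx.2⟩⟩

theorem mem_NSub_iff {kappa : Ordinal.{0}} {S : Set Ordinal.{0}} :
    S ∈ NSub kappa ↔ S ⊆ Set.Iio kappa ∧ ∃ L : Ordinal.{0} → Set Ordinal.{0},
      (∀ alpha ∈ S, L alpha ⊆ Set.Iio alpha) ∧ ∃ C, IsClubIn C kappa ∧
        ∀ alpha ∈ S ∩ C, ∀ beta ∈ S ∩ C, alpha < beta →
          L alpha ≠ L beta ∩ Set.Iio alpha := by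
  simp only [NSub, IsSubtleIn, Set.mem_ofPred_eq]
  refine and_congr_right fun hS => ?_
  push Not
  simp [hS]

theorem mem_NSub_of_subset {kappa : Ordinal.{0}} {X Y : Set Ordinal.{0}}
    (hX : X ∈ NSub kappa) (hYX : Y ⊆ X) : Y ∈ NSub kappa := by
  obtain ⟨hXk, L, hL, C, hC, hne⟩ := mem_NSub_iff.1 hX
  exact mem_NSub_iff.2 ⟨hYX.trans hXk, L, fun a ha => hL a (hYX ha), C, hC,
    fun a ha b hb => hne a ⟨hYX ha.1, ha.2⟩ b ⟨hYX hb.1, hb.2⟩⟩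

theorem empty_mem_NSub {kappa : Ordinal.{0}} (h : IsSuccLimit kappa) : ∅ ∈ NSub kappa :=
  mem_NSub_iff.2 ⟨Set.empty_subset _, fun _ => ∅, fun _ _ => Set.empty_subset _,
    Set.Iio kappa, isClubIn_Iio h, fun _ ha => ha.1.elim⟩

/-- A set is non-subtle if each of its limit elements is in the diagonal union of a family of
non-subtle sets. -/
theorem mem_NSub_of_forall_isSuccLimit {kappa : Ordinal.{0}} (h : RegUncountable kappa)
    {X : Ordinal.{0} → Set Ordinal.{0}} (hX : ∀ alpha < kappa, X alpha ∈ NSub kappa)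
    {S : Set Ordinal.{0}} (hS : S ⊆ Set.Iio kappa)
    (hSX : ∀ beta ∈ S, IsSuccLimit beta → ∃ alpha < beta, beta ∈ X alpha) :
    S ∈ NSub kappa := by
  classical
  have hX' (alpha : Ordinal.{0}) := fun ha => (mem_NSub_iff.1 (hX alpha ha)).2
  choose! L hL C hC hne using hX'
  choose! f hf_lt hf using hSX
  refine mem_NSub_iff.2 ⟨hS,
    fun beta => if IsSuccLimit beta then pairCode (f beta) (L (f beta) beta) else ∅,
    fun beta hb => ?_, limitDiagInter kappa C, isClubIn_limitDiagInter h hC, ?_⟩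
  · dsimp only
    split_ifs with hlim
    · exact pairCode_subset_Iio hlim (hf_lt beta hb hlim)
        (hL _ ((hf_lt beta hb hlim).trans (hS hb)) _ (hf beta hb hlim))
    · exact Set.empty_subset _
  · rintro alpha ⟨haS, hak, hal, haC⟩ beta ⟨hbS, hbk, hbl, hbC⟩ hab heq
    have hfa := hf_lt alpha haS hal
    have hfb := hf_lt beta hbS hbl
    simp only [if_pos hal, if_pos hbl] at heq
    obtain ⟨hfeq, hLeq⟩ := eq_and_eq_of_pairCode_eq hal
      (hL _ (hfa.trans hak) _ (hf alpha haS hal)) heq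
    rw [hfeq] at hfa hLeq
    exact hne (f beta) (hfb.trans hbk) alpha ⟨hfeq ▸ hf alpha haS hal, haC _ hfa⟩
      beta ⟨hf beta hbS hbl, hbC _ hfb⟩ hab hLeq

theorem union_mem_NSub {kappa : Ordinal.{0}} (h : RegUncountable kappa)
    {X Y : Set Ordinal.{0}} (hX : X ∈ NSub kappa) (hY : Y ∈ NSub kappa) :
    X ∪ Y ∈ NSub kappa := by
  classical
  refine mem_NSub_of_forall_isSuccLimit h (X := fun alpha => if alpha = 0 then X else Y)
    (fun alpha _ => ?_) (Set.union_subset hX.1 hY.1) fun beta hb hlim => ?_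
  · split_ifs <;> assumption
  · have h0 : 0 < beta := pos_iff_ne_zero.2 (Ordinal.isSuccLimit_iff.1 hlim).1
    rcases hb with hb | hb
    · exact ⟨0, h0, by simpa using hb⟩
    · exact ⟨succ 0, hlim.succ_lt h0, by simpa using hb⟩

/-- Baumgartner. If `κ` is a subtle cardinal then the collection
`NSub_κ` of non-subtle subsets of `κ` is a normal ideal on `κ`. -/
theorem subtleIdeal_isNormalIdeal (kappa : Ordinal.{0}) (hreg : RegUncountable kappa)
    (hsub : IsSubtleIn (Set.Iio kappa) kappa) :
    IsNormalIdealOn kappa (NSub kappa) := by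
  refine ⟨⟨fun X hX => hX.1, empty_mem_NSub hreg.isSuccLimit,
    fun X hX Y hYX => mem_NSub_of_subset hX hYX,
    fun X hX Y hY => union_mem_NSub hreg hX hY⟩, fun X hX => ?_⟩
  exact mem_NSub_of_forall_isSuccLimit hreg hX (fun _ hb => hb.1) fun _ hb _ => hb.2

end LCI
end

section
/- If κ is a subtle cardinal, then the set {α < κ : α is not a subtle cardinal} is a subtle subset of κ. -/
namespace LCI


/-- The points of `κ` at which `C` is unbounded. -/
def limitPointsBelow (C : Set Ordinal.{0}) (kappa : Ordinal.{0}) : Set Ordinal.{0} :=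
  {beta | beta < kappa ∧ beta ≠ 0 ∧ ∀ gamma < beta, ∃ delta ∈ C, gamma < delta ∧ delta < beta}

theorem IsClubIn.limitPointsBelow_subset {C : Set Ordinal.{0}} {kappa : Ordinal.{0}}
    (hC : IsClubIn C kappa) : limitPointsBelow C kappa ⊆ C :=
  fun beta hbeta => hC.2.2 beta hbeta.1 hbeta.2.1 hbeta.2.2

theorem IsClubIn.inter_Iio {C : Set Ordinal.{0}} {kappa alpha : Ordinal.{0}}
    (hC : IsClubIn C kappa) (halpha : alpha ∈ limitPointsBelow C kappa) :
    IsClubIn (C ∩ Set.Iio alpha) alpha := by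
  refine ⟨Set.inter_subset_right, fun gamma hgamma => ?_, fun beta hbeta h0 hlim => ?_⟩
  · obtain ⟨delta, hdelta, h1, h2⟩ := halpha.2.2 gamma hgamma
    exact ⟨delta, ⟨hdelta, h2⟩, h1⟩
  · refine ⟨hC.2.2 beta (hbeta.trans halpha.1) h0 fun gamma hgamma => ?_, hbeta⟩
    obtain ⟨delta, hdelta, h⟩ := hlim gamma hgamma
    exact ⟨delta, hdelta.1, h⟩

theorem IsClubIn.inter_Ioi {C : Set Ordinal.{0}} {kappa gamma : Ordinal.{0}}
    (hC : IsClubIn C kappa) (hgamma : gamma < kappa) : IsClubIn (C ∩ Set.Ioi gamma) kappa := by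
  refine ⟨fun x hx => hC.1 hx.1, fun alpha halpha => ?_, fun beta hbeta h0 hlim => ⟨?_, ?_⟩⟩
  · obtain ⟨beta, hbeta, h⟩ := hC.2.1 (max alpha gamma) (max_lt halpha hgamma)
    exact ⟨beta, ⟨hbeta, (le_max_right _ _).trans_lt h⟩, (le_max_left _ _).trans_lt h⟩
  · refine hC.2.2 beta hbeta h0 fun x hx => ?_
    obtain ⟨delta, hdelta, h⟩ := hlim x hx
    exact ⟨delta, hdelta.1, h⟩
  · obtain ⟨delta, hdelta, -, h⟩ := hlim 0 (pos_iff_ne_zero.2 h0)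
    exact lt_trans hdelta.2 h

/-- If the limit points of `C` were bounded by `γ`, the list sending `α` to the set of `x < α`
with no element of `C` strictly between `x` and `α` would have no coherent pair in
`C ∩ (γ, κ)`. -/
theorem IsSubtleIn.isClubIn_limitPointsBelow {C : Set Ordinal.{0}} {kappa : Ordinal.{0}}
    (hsub : IsSubtleIn (Set.Iio kappa) kappa) (hC : IsClubIn C kappa) :
    IsClubIn (limitPointsBelow C kappa) kappa := by
  refine ⟨fun x hx => hx.1, fun gamma hgamma => ?_, fun beta hbeta h0 hlim =>
    ⟨hbeta, h0, fun gamma hgamma => ?_⟩⟩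
  · by_contra! hbdd
    obtain ⟨alpha, halpha, beta, hbeta, hlt, heq⟩ :=
      hsub.2 (fun alpha => {x | x < alpha ∧ ∀ delta ∈ C, x < delta → alpha ≤ delta})
        (fun alpha _ x hx => hx.1) _ (hC.inter_Ioi hgamma)
    have hnot : alpha ∉ limitPointsBelow C kappa := fun h =>
      (hbdd alpha h).not_gt halpha.2.2
    have hne : ∃ x < alpha, ∀ delta ∈ C, x < delta → alpha ≤ delta := by
      by_contra! h
      exact hnot ⟨halpha.1, (bot_le.trans_lt halpha.2.2).ne', h⟩
    obtain ⟨x, hx⟩ := hne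
    have hmem : x ∈ {x | x < beta ∧ ∀ delta ∈ C, x < delta → beta ≤ delta} ∩ Set.Iio alpha :=
      heq.subset hx
    exact (hmem.1.2 alpha halpha.2.1 hx.1).not_gt hlt
  · obtain ⟨delta, hdelta, h1, h2⟩ := hlim gamma hgamma
    obtain ⟨epsilon, hepsilon, h3, h4⟩ := hdelta.2.2 gamma h1
    exact ⟨epsilon, hepsilon, h3, h4.trans h2⟩

/-- By induction, a limit point of `C` that is itself subtle already has a coherent pair of
non-subtle ordinals of `C` below it; otherwise every limit point of `C` is non-subtle. -/
theorem IsSubtleIn.nonSubtles {kappa : Ordinal.{0}} (hsub : IsSubtleIn (Set.Iio kappa) kappa) :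
    IsSubtleIn {alpha | alpha < kappa ∧ ¬ IsSubtleIn (Set.Iio alpha) alpha} kappa := by
  induction kappa using WellFoundedLT.induction with
  | ind kappa ih =>
    refine ⟨fun x hx => hx.1, fun L hL C hC => ?_⟩
    by_cases hex : ∃ alpha ∈ limitPointsBelow C kappa, IsSubtleIn (Set.Iio alpha) alpha
    · obtain ⟨alpha, halpha, hsubalpha⟩ := hex
      obtain ⟨x, ⟨hx, hxC⟩, y, ⟨hy, hyC⟩, h⟩ := (ih alpha halpha.1 hsubalpha).2 L
        (fun x hx => hL x ⟨hx.1.trans halpha.1, hx.2⟩) _ (hC.inter_Iio halpha)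
      exact ⟨x, ⟨⟨hx.1.trans halpha.1, hx.2⟩, hxC.1⟩,
        y, ⟨⟨hy.1.trans halpha.1, hy.2⟩, hyC.1⟩, h⟩
    · push Not at hex
      obtain ⟨x, ⟨-, hx⟩, y, ⟨-, hy⟩, hlt, heq⟩ := hsub.2 (fun alpha => L alpha ∩ Set.Iio alpha)
        (fun _ _ => Set.inter_subset_right) _ (hsub.isClubIn_limitPointsBelow hC)
      have hxS := hL x ⟨hx.1, hex x hx⟩
      have hyS := hL y ⟨hy.1, hex y hy⟩
      refine ⟨x, ⟨⟨hx.1, hex x hx⟩, hC.limitPointsBelow_subset hx⟩,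
        y, ⟨⟨hy.1, hex y hy⟩, hC.limitPointsBelow_subset hy⟩, hlt, ?_⟩
      simpa only [Set.inter_eq_left.2 hxS, Set.inter_eq_left.2 hyS] using heq

/-- If `κ` is a subtle cardinal then the set of `α < κ` which are not
subtle cardinals is a subtle subset of `κ`. -/
theorem nonSubtles_subtle (kappa : Ordinal.{0}) (hreg : RegUncountable kappa)
    (hsub : IsSubtleIn (Set.Iio kappa) kappa) :
    IsSubtleIn {alpha | alpha < kappa ∧ ¬ IsSubtleIn (Set.Iio alpha) alpha} kappa :=
  hsub.nonSubtles

end LCI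
end

section
/- For every regular uncountable cardinal κ and every ideal I on κ with [κ]^{<κ} ⊆ I, the collection R(I) is a normal ideal on κ. -/
namespace LCI


/-- `f : [S]^{<ω} → κ` is regressive : `f a < min a` for every nonempty finite `a ⊆ S`. -/
def Regressive (S : Set Ordinal.{0}) (f : Finset Ordinal.{0} → Ordinal.{0}) : Prop :=
  ∀ a : Finset Ordinal.{0}, (↑a : Set Ordinal.{0}) ⊆ S → ∀ h : a.Nonempty, f a < a.min' h

/-- `H` is homogeneous for `f : [κ]^{<ω} → β` : `f` is constant on `[H]^n` for each `n`. -/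
def HomogFn {beta : Type*} (H : Set Ordinal.{0}) (f : Finset Ordinal.{0} → beta) : Prop :=
  ∀ a b : Finset Ordinal.{0}, (↑a : Set Ordinal.{0}) ⊆ H → (↑b : Set Ordinal.{0}) ⊆ H →
    a.card = b.card → f a = f b

/-- `L` is an `(ω,S)`-list : to each finite nonempty `a ⊆ S` (i.e. each increasing tuple
from `S`) it assigns a subset of `min a`. -/
def IsOmegaList (S : Set Ordinal.{0}) (L : Finset Ordinal.{0} → Set Ordinal.{0}) : Prop :=
  ∀ a : Finset Ordinal.{0}, (↑a : Set Ordinal.{0}) ⊆ S → ∀ h : a.Nonempty,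
    L a ⊆ Set.Iio (a.min' h)

/-- `H` is homogeneous for the `(ω,S)`-list `L` : for increasing tuples `a`, `b` from `H`
of the same length with `min a ≤ min b`, `L a = L b ∩ min a`. -/
def HomogOmegaList (H : Set Ordinal.{0}) (L : Finset Ordinal.{0} → Set Ordinal.{0}) : Prop :=
  ∀ a b : Finset Ordinal.{0}, (↑a : Set Ordinal.{0}) ⊆ H → (↑b : Set Ordinal.{0}) ⊆ H →
    a.card = b.card → ∀ (ha : a.Nonempty) (hb : b.Nonempty),
      a.min' ha ≤ b.min' hb → L a = L b ∩ Set.Iio (a.min' ha)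

/-- `S ∈ 𝓡(I)⁺` : every regressive `f : [S]^{<ω} → κ` has a homogeneous set in
`P(S) ∩ I⁺`. -/
def RPos (kappa : Ordinal.{0}) (I : Set (Set Ordinal.{0})) (S : Set Ordinal.{0}) : Prop :=
  S ⊆ Set.Iio kappa ∧
  ∀ f : Finset Ordinal.{0} → Ordinal.{0}, Regressive S f →
    ∃ H, H ⊆ S ∧ H ∉ I ∧ HomogFn H f

/-- The ideal `𝓡(I)` on `κ`. -/
def RIdeal (kappa : Ordinal.{0}) (I : Set (Set Ordinal.{0})) : Set (Set Ordinal.{0}) :=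
  {X | X ⊆ Set.Iio kappa ∧ ¬ RPos kappa I X}

theorem mem_rIdeal_iff {kappa : Ordinal.{0}} {I : Set (Set Ordinal.{0})} {S : Set Ordinal.{0}} :
    S ∈ RIdeal kappa I ↔ S ⊆ Set.Iio kappa ∧
      ∃ f, Regressive S f ∧ ∀ H ⊆ S, H ∉ I → ¬ HomogFn H f := by
  simp only [RIdeal, RPos, Set.mem_ofPred_eq]
  refine and_congr_right fun hS => ?_
  simp [hS]

theorem pos_of_mem_rIdeal {kappa : Ordinal.{0}} {I : Set (Set Ordinal.{0})} {S : Set Ordinal.{0}}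
    (hS : S ∈ RIdeal kappa I) {beta : Ordinal.{0}} (hbeta : beta ∈ S) : 0 < beta := by
  obtain ⟨-, f, hf, -⟩ := mem_rIdeal_iff.1 hS
  have h := hf {beta} (by simpa using hbeta) (Finset.singleton_nonempty beta)
  rw [Finset.min'_singleton] at h
  exact zero_le.trans_lt h

theorem inter_Iic_mem {kappa : Ordinal.{0}} (hreg : RegUncountable kappa)
    {I : Set (Set Ordinal.{0})}
    (hsmall : ∀ X, X ⊆ Set.Iio kappa → Cardinal.mk ↥X < Cardinal.lift.{1} kappa.card → X ∈ I)
    {S : Set Ordinal.{0}} {delta : Ordinal.{0}} (hdelta : delta < kappa) :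
    S ∩ Set.Iic delta ∈ I := by
  obtain ⟨homega, hcof⟩ := hreg
  have hlim : Order.IsSuccLimit kappa := by
    rw [← hcof]
    refine Cardinal.isSuccLimit_ord ?_
    rw [← Cardinal.ord_le_ord, Cardinal.ord_aleph0, hcof]
    exact homega.le
  have hsucc : Order.succ delta < kappa := hlim.succ_lt hdelta
  refine hsmall _ (fun x hx => lt_of_le_of_lt hx.2 hdelta) ?_
  calc Cardinal.mk ↥(S ∩ Set.Iic delta)
      ≤ Cardinal.mk ↥(Set.Iio (Order.succ delta)) :=
        Cardinal.mk_le_mk_of_subset fun x hx => Set.mem_Iio.2 (Order.lt_succ_iff.2 hx.2)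
    _ = Cardinal.lift.{1} (Order.succ delta).card := Cardinal.mk_Iio_ordinal _
    _ < Cardinal.lift.{1} kappa.card := by
      rw [Cardinal.lift_lt]
      rw [← hcof] at hsucc ⊢
      rw [Cardinal.card_ord]
      exact Cardinal.lt_ord.1 hsucc

open Classical in
/-- On singletons this is `g`; on larger sets `a` it is `F (g (min a))` evaluated at `a` without
its maximum. Values that are not below `min a` are replaced by `0`. -/
noncomputable def glue (g : Ordinal.{0} → Ordinal.{0})
    (F : Ordinal.{0} → Finset Ordinal.{0} → Ordinal.{0}) (a : Finset Ordinal.{0}) : Ordinal.{0} :=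
  if h : a.Nonempty then
    let v := if a.card = 1 then g (a.min' h) else F (g (a.min' h)) (a.erase (a.max' h))
    if v < a.min' h then v else 0
  else 0

theorem regressive_glue (g : Ordinal.{0} → Ordinal.{0})
    (F : Ordinal.{0} → Finset Ordinal.{0} → Ordinal.{0}) {S : Set Ordinal.{0}}
    (hS : ∀ beta ∈ S, 0 < beta) : Regressive S (glue g F) := by
  intro a ha h
  simp only [glue, h, dif_pos]
  split_ifs with h1 h2 h2
  exacts [h2, hS _ (ha (a.min'_mem h)), h2, hS _ (ha (a.min'_mem h))]

theorem glue_singleton (g : Ordinal.{0} → Ordinal.{0})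
    (F : Ordinal.{0} → Finset Ordinal.{0} → Ordinal.{0}) {beta : Ordinal.{0}}
    (hg : g beta < beta) : glue g F {beta} = g beta := by
  simp [glue, hg]

theorem glue_insert (g : Ordinal.{0} → Ordinal.{0})
    (F : Ordinal.{0} → Finset Ordinal.{0} → Ordinal.{0}) {a : Finset Ordinal.{0}}
    (ha : a.Nonempty) {gamma : Ordinal.{0}} (hgamma : ∀ x ∈ a, x < gamma)
    (hF : F (g (a.min' ha)) a < a.min' ha) :
    glue g F (insert gamma a) = F (g (a.min' ha)) a := by
  have hnot : gamma ∉ a := fun h => (hgamma _ h).false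
  have hmin : (insert gamma a).min' (Finset.insert_nonempty _ _) = a.min' ha := by
    rw [Finset.min'_insert _ _ ha]
    exact min_eq_right (hgamma _ (a.min'_mem ha)).le
  have hmax : (insert gamma a).max' (Finset.insert_nonempty _ _) = gamma := by
    rw [Finset.max'_insert _ _ ha]
    exact max_eq_left (hgamma _ (a.max'_mem ha)).le
  have hcard : (insert gamma a).card ≠ 1 := by
    rw [Finset.card_insert_of_notMem hnot]
    have := ha.card_pos
    omega
  simp only [glue, Finset.insert_nonempty, dif_pos, hcard, if_false, hmin, hmax,
    Finset.erase_insert hnot, hF, if_true]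

theorem mem_rIdeal_of_regressive_choice {kappa : Ordinal.{0}} (hreg : RegUncountable kappa)
    {I : Set (Set Ordinal.{0})} (hI : IsIdealOn kappa I)
    (hsmall : ∀ X, X ⊆ Set.Iio kappa → Cardinal.mk ↥X < Cardinal.lift.{1} kappa.card → X ∈ I)
    {X : Ordinal.{0} → Set Ordinal.{0}} (hX : ∀ alpha < kappa, X alpha ∈ RIdeal kappa I)
    {S : Set Ordinal.{0}} (hS : S ⊆ Set.Iio kappa) {g : Ordinal.{0} → Ordinal.{0}}
    (hg : ∀ beta ∈ S, g beta < beta) {delta : Ordinal.{0}} (hdelta : delta < kappa)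
    (hgX : ∀ beta ∈ S, delta < beta → beta ∈ X (g beta)) : S ∈ RIdeal kappa I := by
  obtain ⟨-, -, hsub, hunion⟩ := hI
  choose! F hF hFH using fun alpha halpha => (mem_rIdeal_iff.1 (hX alpha halpha)).2
  refine mem_rIdeal_iff.2 ⟨hS, glue g F,
    regressive_glue g F fun beta hbeta => zero_le.trans_lt (hg beta hbeta), ?_⟩
  intro H hHS hHI hhom
  have hunbdd : ∀ eta < kappa, ∃ gamma ∈ H, eta < gamma := by
    intro eta heta
    by_contra! hcon
    refine hHI ?_
    rw [← Set.inter_eq_left.2 (show H ⊆ Set.Iic eta from hcon)]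
    exact inter_Iic_mem hreg hsmall heta
  have htail : H ∩ Set.Ioi delta ∉ I := by
    intro h
    refine hHI (hsub _ (hunion _ h _ (inter_Iic_mem hreg hsmall (S := H) hdelta)) _ ?_)
    intro x hx
    rcases lt_or_ge delta x with hlt | hle
    exacts [Or.inl ⟨hx, hlt⟩, Or.inr ⟨hx, hle⟩]
  obtain ⟨beta, hbeta, -⟩ := hunbdd delta hdelta
  have hconst : ∀ x ∈ H, g x = g beta := by
    intro x hx
    rw [← glue_singleton g F (hg x (hHS hx)), ← glue_singleton g F (hg beta (hHS hbeta))]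
    exact hhom _ _ (by simpa using hx) (by simpa using hbeta) (by simp)
  have hgk : g beta < kappa := (hg beta (hHS hbeta)).trans (hS (hHS hbeta))
  have hHX : H ∩ Set.Ioi delta ⊆ X (g beta) := fun x hx =>
    hconst x hx.1 ▸ hgX x (hHS hx.1) hx.2
  have heval : ∀ a : Finset Ordinal.{0}, ↑a ⊆ H ∩ Set.Ioi delta → a.Nonempty →
      ∀ gamma, (∀ x ∈ a, x < gamma) → glue g F (insert gamma a) = F (g beta) a := by
    intro a ha hne gamma hgamma
    have hgmin : g (a.min' hne) = g beta := hconst _ (ha (a.min'_mem hne)).1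
    rw [← hgmin]
    refine glue_insert g F hne hgamma ?_
    rw [hgmin]
    exact hF _ hgk a (ha.trans hHX) hne
  refine hFH _ hgk _ hHX htail fun a b ha hb hab => ?_
  rcases a.eq_empty_or_nonempty with rfl | hane
  · rw [Finset.card_eq_zero.1 (hab.symm.trans Finset.card_empty)]
  have hbne : b.Nonempty := Finset.card_pos.1 (hab ▸ hane.card_pos)
  obtain ⟨gamma, hgamma, hlt⟩ := hunbdd (max (a.max' hane) (b.max' hbne))
    (max_lt (hS (hHS (ha (a.max'_mem hane)).1)) (hS (hHS (hb (b.max'_mem hbne)).1)))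
  have hagamma : ∀ x ∈ a, x < gamma := fun x hx =>
    (a.le_max' x hx).trans_lt ((le_max_left _ _).trans_lt hlt)
  have hbgamma : ∀ x ∈ b, x < gamma := fun x hx =>
    (b.le_max' x hx).trans_lt ((le_max_right _ _).trans_lt hlt)
  rw [← heval a ha hane gamma hagamma, ← heval b hb hbne gamma hbgamma]
  refine hhom _ _ ?_ ?_ ?_
  · rw [Finset.coe_insert]
    exact Set.insert_subset hgamma fun x hx => (ha hx).1
  · rw [Finset.coe_insert]
    exact Set.insert_subset hgamma fun x hx => (hb hx).1
  · rw [Finset.card_insert_of_notMem fun h => (hagamma _ h).false,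
      Finset.card_insert_of_notMem fun h => (hbgamma _ h).false, hab]

/-- Feng. For every regular uncountable `κ` and every ideal
`I ⊇ [κ]^{<κ}` on `κ`, the collection `𝓡(I)` is a normal ideal on `κ`. -/
theorem rIdeal_isNormalIdeal (kappa : Ordinal.{0}) (hreg : RegUncountable kappa)
    (I : Set (Set Ordinal.{0})) (hI : IsIdealOn kappa I)
    (hsmall : ∀ X, X ⊆ Set.Iio kappa → Cardinal.mk ↥X < Cardinal.lift.{1} kappa.card → X ∈ I) :
    IsNormalIdealOn kappa (RIdeal kappa I) := by
  have hone : (1 : Ordinal.{0}) < kappa := Ordinal.one_lt_omega0.trans hreg.1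
  refine ⟨⟨fun X hX => hX.1, ?_, ?_, ?_⟩, ?_⟩
  · refine mem_rIdeal_iff.2 ⟨Set.empty_subset _, fun _ => 0, ?_, ?_⟩
    · intro a ha h
      exact (ha (a.min'_mem h)).elim
    · intro H hH hHI
      exact absurd (Set.subset_empty_iff.1 hH ▸ hI.2.1) hHI
  · intro X hX Y hYX
    obtain ⟨hXk, f, hf, hfH⟩ := mem_rIdeal_iff.1 hX
    exact mem_rIdeal_iff.2 ⟨hYX.trans hXk, f, fun a ha => hf a (ha.trans hYX),
      fun H hH => hfH H (hH.trans hYX)⟩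
  · intro X hX Y hY
    classical
    refine mem_rIdeal_of_regressive_choice hreg hI hsmall
      (X := fun alpha => if alpha = 0 then X else Y)
      (g := fun beta => if beta ∈ X then 0 else if 1 < beta then 1 else 0)
      (fun alpha _ => ?_) (Set.union_subset hX.1 hY.1) (fun beta hbeta => ?_) hone
      (fun beta hbeta hlt => ?_)
    · split_ifs
      exacts [hX, hY]
    · have hpos : 0 < beta := hbeta.elim (pos_of_mem_rIdeal hX) (pos_of_mem_rIdeal hY)
      split_ifs with h1 h2
      exacts [hpos, h2, hpos]
    · by_cases h : beta ∈ X
      · simp [h]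
      · simpa [h, hlt] using hbeta
  · intro X hX
    have hchoice : ∀ beta ∈ diagUnion kappa X, ∃ alpha < beta, beta ∈ X alpha :=
      fun beta hbeta => hbeta.2
    choose! g hg hgX using hchoice
    exact mem_rIdeal_of_regressive_choice hreg hI hsmall hX (fun beta hbeta => hbeta.1) hg
      (zero_lt_one.trans hone) fun beta hbeta _ => hgX beta hbeta

end LCI
end

section
/- If κ is a weakly compact cardinal and I is a κ-complete ideal on κ such that every I-positive set S can be written as a disjoint union S = S_0 ⊔ S_1 of two I-positive sets, then I is nowhere κ-saturated. -/
namespace LCI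


/-- The restriction `I ↾ S = {X ⊆ κ : X ∩ S ∈ I}` of an ideal on `κ`. -/
def restrictIdeal (kappa : Ordinal.{0}) (I : Set (Set Ordinal.{0})) (S : Set Ordinal.{0}) :
    Set (Set Ordinal.{0}) :=
  {X | X ⊆ Set.Iio kappa ∧ X ∩ S ∈ I}

/-- `I` is `ν`-saturated : there is no family of `ν` many `I`-positive subsets of `κ`
whose pairwise intersections lie in `I`. -/
def IsSatAt (nu : Cardinal.{0}) (kappa : Ordinal.{0}) (I : Set (Set Ordinal.{0})) : Prop :=
  ¬ ∃ A : Ordinal.{0} → Set Ordinal.{0},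
      (∀ alpha < nu.ord, A alpha ⊆ Set.Iio kappa ∧ A alpha ∉ I) ∧
      ∀ alpha < nu.ord, ∀ beta < nu.ord, alpha ≠ beta → A alpha ∩ A beta ∈ I

/-- `I` is nowhere `κ`-saturated : `I ↾ S` is not `κ`-saturated for every `I`-positive `S`. -/
def NowhereKappaSat (kappa : Ordinal.{0}) (I : Set (Set Ordinal.{0})) : Prop :=
  ∀ S, S ⊆ Set.Iio kappa → S ∉ I → ¬ IsSatAt kappa.card kappa (restrictIdeal kappa I S)

/-- `κ` is weakly compact : `κ` is uncountable and satisfies the partition property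
`κ → (κ)²₂` (equivalently, `κ` is inaccessible and every `κ`-tree has a cofinal branch). -/
def WeaklyCompact (kappa : Ordinal.{0}) : Prop :=
  Ordinal.omega0 < kappa ∧
  ∀ f : Ordinal.{0} → Ordinal.{0} → Fin 2,
    ∃ H, H ⊆ Set.Iio kappa ∧ Cardinal.mk ↥H = Cardinal.lift.{1} kappa.card ∧
      ∀ alpha ∈ H, ∀ beta ∈ H, ∀ gamma ∈ H, ∀ delta ∈ H,
        alpha < beta → gamma < delta → f alpha beta = f gamma delta

/-- `I` is a `κ`-complete ideal : closed under unions of fewer than `κ` of its members. -/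
def KComplete (kappa : Ordinal.{0}) (I : Set (Set Ordinal.{0})) : Prop :=
  ∀ s : Set (Set Ordinal.{0}), s ⊆ I → Cardinal.mk ↥s < Cardinal.lift.{1} kappa.card → ⋃₀ s ∈ I

/-- Every colouring of the pairs below the initial ordinal of a weakly compact `κ` has a homogeneous
set of full size. -/
theorem WeaklyCompact.exists_homogeneous {kappa : Ordinal.{0}} (hwc : WeaklyCompact kappa)
    (f : Ordinal.{0} → Ordinal.{0} → Prop) :
    ∃ H ⊆ Set.Iio kappa.card.ord, Cardinal.mk ↥H = Cardinal.lift.{1} kappa.card ∧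
      ∃ c : Prop, ∀ alpha ∈ H, ∀ beta ∈ H, alpha < beta → (f alpha beta ↔ c) := by
  classical
  have hmk : Cardinal.mk ↥(Set.Iio kappa) = Cardinal.mk ↥(Set.Iio kappa.card.ord) := by
    simp [Cardinal.mk_Iio_ordinal]
  obtain ⟨g⟩ := Cardinal.eq.1 hmk
  let g' : Ordinal.{0} → Ordinal.{0} := fun a => if h : a < kappa then (g ⟨a, h⟩ : Ordinal.{0}) else 0
  have hg' : ∀ a (h : a < kappa), g' a = (g ⟨a, h⟩ : Ordinal.{0}) := fun a h => dif_pos h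
  have hinj : Set.InjOn g' (Set.Iio kappa) := by
    intro a ha b hb hab
    rw [hg' a ha, hg' b hb] at hab
    simpa using g.injective (Subtype.ext hab)
  obtain ⟨H, hH, hcard, hhom⟩ := hwc.2 fun a b =>
    if f (min (g' a) (g' b)) (max (g' a) (g' b)) then 1 else 0
  have key : ∀ a ∈ H, ∀ b ∈ H, ∀ a' ∈ H, ∀ b' ∈ H, g' a < g' b → g' a' < g' b' →
      f (g' a) (g' b) → f (g' a') (g' b') := by
    intro a ha b hb a' ha' b' hb' h h' hf
    have hne : a ≠ b := by rintro rfl; exact h.false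
    have hne' : a' ≠ b' := by rintro rfl; exact h'.false
    rcases hne.lt_or_gt with hl | hl <;> rcases hne'.lt_or_gt with hl' | hl'
    · have := hhom a ha b hb a' ha' b' hb' hl hl'
      by_contra hn
      simp [min_eq_left h.le, max_eq_right h.le, min_eq_left h'.le, max_eq_right h'.le, hf, hn]
        at this
    · have := hhom a ha b hb b' hb' a' ha' hl hl'
      by_contra hn
      simp [min_eq_left h.le, max_eq_right h.le, min_eq_right h'.le, max_eq_left h'.le, hf, hn]
        at this
    · have := hhom b hb a ha a' ha' b' hb' hl hl'
      by_contra hn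
      simp [min_eq_right h.le, max_eq_left h.le, min_eq_left h'.le, max_eq_right h'.le, hf, hn]
        at this
    · have := hhom b hb a ha b' hb' a' ha' hl hl'
      by_contra hn
      simp [min_eq_right h.le, max_eq_left h.le, min_eq_right h'.le, max_eq_left h'.le, hf, hn]
        at this
  refine ⟨g' '' H, ?_, ?_, ∃ a ∈ H, ∃ b ∈ H, g' a < g' b ∧ f (g' a) (g' b), ?_⟩
  · rintro _ ⟨a, ha, rfl⟩
    rw [hg' a (hH ha)]
    exact (g ⟨a, hH ha⟩).2
  · rw [Cardinal.mk_image_eq_of_injOn _ _ (hinj.mono hH), hcard]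
  · rintro _ ⟨a, ha, rfl⟩ _ ⟨b, hb, rfl⟩ hab
    refine ⟨fun h => ⟨a, ha, b, hb, hab, h⟩, ?_⟩
    rintro ⟨a', ha', b', hb', hab', h'⟩
    exact key a' ha' b' hb' a ha b hb hab' hab h'

theorem aleph0_le_card_of_weaklyCompact {kappa : Ordinal.{0}} (hwc : WeaklyCompact kappa) :
    Cardinal.aleph0 ≤ kappa.card := by
  simpa using Ordinal.card_le_card hwc.1.le

/-- A subset of an infinite initial ordinal of full size is unbounded. -/
theorem exists_gt_of_mk_eq {c : Cardinal.{0}} (hc : Cardinal.aleph0 ≤ c) {H : Set Ordinal.{0}}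
    (hH : Cardinal.mk ↥H = Cardinal.lift.{1} c) {xi : Ordinal.{0}} (hxi : xi < c.ord) :
    ∃ eta ∈ H, xi < eta := by
  by_contra! h
  have hsub : H ⊆ Set.Iio (Order.succ xi) := fun eta he => Order.lt_succ_of_le (h eta he)
  have hle := Cardinal.mk_le_mk_of_subset hsub
  rw [hH, Cardinal.mk_Iio_ordinal, Cardinal.lift_le] at hle
  exact (Cardinal.lt_ord.1 ((Cardinal.isSuccLimit_ord hc).succ_lt hxi)).not_ge hle

/-- The initial ordinal of a weakly compact `κ` is regular. -/
theorem WeaklyCompact.exists_bound {kappa : Ordinal.{0}} (hwc : WeaklyCompact kappa)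
    {alpha : Ordinal.{0}} (halpha : alpha < kappa.card.ord) (g : Ordinal.{0} → Ordinal.{0})
    (hg : ∀ beta < alpha, g beta < kappa.card.ord) :
    ∃ xi < kappa.card.ord, ∀ beta < alpha, g beta ≤ xi := by
  by_contra! hcon
  choose! h hlt hgt using hcon
  have hinf := aleph0_le_card_of_weaklyCompact hwc
  obtain ⟨H, hH, hcard, c, hhom⟩ := hwc.exists_homogeneous fun a b => h a = h b
  by_cases hcc : c
  · obtain ⟨a, ha, -⟩ := exists_gt_of_mk_eq hinf hcard (zero_le.trans_lt halpha)
    obtain ⟨b, hb, hab⟩ := exists_gt_of_mk_eq hinf hcard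
      (max_lt (hH ha) (hg (h a) (hlt a (hH ha))))
    have heq := (hhom a ha b hb ((le_max_left _ _).trans_lt hab)).2 hcc
    have := hgt b (hH hb)
    rw [← heq] at this
    exact this.not_gt ((le_max_right _ _).trans_lt hab)
  · have hinj : Set.InjOn h H := by
      intro a ha b hb hab
      by_contra hne
      rcases Ne.lt_or_gt hne with hl | hl
      · exact hcc ((hhom a ha b hb hl).1 hab)
      · exact hcc ((hhom b hb a ha hl).1 hab.symm)
    have hsub : h '' H ⊆ Set.Iio alpha := by
      rintro _ ⟨a, ha, rfl⟩
      exact hlt a (hH ha)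
    have hle := Cardinal.mk_le_mk_of_subset hsub
    rw [Cardinal.mk_image_eq_of_injOn _ _ hinj, hcard, Cardinal.mk_Iio_ordinal,
      Cardinal.lift_le] at hle
    exact (Cardinal.lt_ord.1 halpha).not_ge hle

/-- `e a` precedes `e b` in the lexicographic order. -/
def LexLT (e : Ordinal.{0} → Ordinal.{0} → Prop) (a b : Ordinal.{0}) : Prop :=
  ∃ alpha, ¬ e a alpha ∧ e b alpha ∧ ∀ beta < alpha, (e a beta ↔ e b beta)

/-- Lexicographically monotone sequences of full length stabilise at each coordinate. -/
theorem WeaklyCompact.exists_stable {kappa : Ordinal.{0}} (hwc : WeaklyCompact kappa)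
    (e : Ordinal.{0} → Ordinal.{0} → Prop) {H : Set Ordinal.{0}}
    (hH : H ⊆ Set.Iio kappa.card.ord) {c : Prop}
    (hhom : ∀ a ∈ H, ∀ b ∈ H, a < b → (LexLT e a b ↔ c)) (alpha : Ordinal.{0})
    (halpha : alpha < kappa.card.ord) :
    ∃ xi < kappa.card.ord, ∀ a ∈ H, ∀ b ∈ H, xi ≤ a → xi ≤ b → (e a alpha ↔ e b alpha) := by
  induction alpha using WellFoundedLT.induction with
  | ind alpha ih =>
  have ih' : ∀ beta < alpha, ∃ xi < kappa.card.ord, ∀ a ∈ H, ∀ b ∈ H, xi ≤ a → xi ≤ b →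
      (e a beta ↔ e b beta) := fun beta hb => ih beta hb (hb.trans halpha)
  choose! g hg hstab using ih'
  obtain ⟨xi, hxi, hbd⟩ := hwc.exists_bound halpha g hg
  have hagree : ∀ a ∈ H, ∀ b ∈ H, xi ≤ a → xi ≤ b → ∀ beta < alpha, (e a beta ↔ e b beta) :=
    fun a ha b hb hxa hxb beta hbeta => hstab beta hbeta a ha b hb
      ((hbd beta hbeta).trans hxa) ((hbd beta hbeta).trans hxb)
  have hpersist : ∀ a ∈ H, xi ≤ a → (e a alpha ↔ c) → ∀ b ∈ H, a < b → (e b alpha ↔ c) := by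
    intro a ha hxa hea b hb hab
    have hlex := hhom a ha b hb hab
    have hag := hagree a ha b hb hxa (hxa.trans hab.le)
    by_cases hcc : c
    · obtain ⟨d, hd, hd', hbelow⟩ := hlex.2 hcc
      rcases lt_trichotomy d alpha with h | rfl | h
      · exact absurd ((hag d h).2 hd') hd
      · exact absurd (hea.2 hcc) hd
      · rw [← hbelow alpha h, hea]
    · refine iff_of_false (fun hb' => hcc (hlex.1 ⟨alpha, fun h => hcc (hea.1 h), hb', hag⟩)) hcc
  by_cases hex : ∃ a ∈ H, xi ≤ a ∧ (e a alpha ↔ c)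
  · obtain ⟨a, ha, hxa, hea⟩ := hex
    have hall : ∀ b ∈ H, a ≤ b → (e b alpha ↔ c) := by
      intro b hb hab
      rcases hab.eq_or_lt with rfl | hlt
      · exact hea
      · exact hpersist a ha hxa hea b hb hlt
    exact ⟨a, hH ha, fun b hb b' hb' h h' => (hall b hb h).trans (hall b' hb' h').symm⟩
  · refine ⟨xi, hxi, fun a ha b hb hxa hxb => ?_⟩
    have h1 : ¬ (e a alpha ↔ c) := fun h => hex ⟨a, ha, hxa, h⟩
    have h2 : ¬ (e b alpha ↔ c) := fun h => hex ⟨b, hb, hxb, h⟩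
    tauto

/-- Points of `S` follow a transfinite sequence of binary splittings, the cell `X` being split into
`P X` and its complement; `path P S α x` says that at stage `α` the point `x` goes to the `P`
side. -/
def path (P : Set Ordinal.{0} → Set Ordinal.{0}) (S : Set Ordinal.{0}) (alpha : Ordinal.{0})
    (x : Ordinal.{0}) : Prop :=
  x ∈ P {y | y ∈ S ∧ ∀ beta, beta < alpha → (path P S beta y ↔ path P S beta x)}
termination_by alpha

/-- The cell of `S` determined up to stage `α` by the choices `b`. -/
def cell (P : Set Ordinal.{0} → Set Ordinal.{0}) (S : Set Ordinal.{0}) (b : Ordinal.{0} → Prop)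
    (alpha : Ordinal.{0}) : Set Ordinal.{0} :=
  {y | y ∈ S ∧ ∀ beta < alpha, (path P S beta y ↔ b beta)}

theorem cell_congr {P : Set Ordinal.{0} → Set Ordinal.{0}} {S : Set Ordinal.{0}}
    {b b' : Ordinal.{0} → Prop} {alpha : Ordinal.{0}} (h : ∀ beta < alpha, (b beta ↔ b' beta)) :
    cell P S b alpha = cell P S b' alpha := by
  ext y
  exact and_congr_right fun _ => forall₂_congr fun beta hb => by rw [h beta hb]

theorem path_iff_mem {P : Set Ordinal.{0} → Set Ordinal.{0}} {S : Set Ordinal.{0}}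
    {b : Ordinal.{0} → Prop} {alpha x : Ordinal.{0}} (hx : x ∈ cell P S b alpha) :
    path P S alpha x ↔ x ∈ P (cell P S b alpha) := by
  rw [path, ← cell_congr hx.2]
  rfl

/-- A branch of positive cells yields a disjoint family of positive sets. -/
theorem not_isSatAt_of_branch {nu : Cardinal.{0}} {kappa : Ordinal.{0}}
    {I : Set (Set Ordinal.{0})} (hI : IsIdealOn kappa I) {S : Set Ordinal.{0}}
    (hS : S ⊆ Set.Iio kappa) {P : Set Ordinal.{0} → Set Ordinal.{0}}
    (hP : ∀ X, X ⊆ Set.Iio kappa → X ∉ I → P X ⊆ X ∧ P X ∉ I ∧ X \ P X ∉ I)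
    (b : Ordinal.{0} → Prop) (hb : ∀ alpha < nu.ord, cell P S b alpha ∉ I) :
    ¬ IsSatAt nu kappa (restrictIdeal kappa I S) := by
  rw [IsSatAt, not_not]
  have hdisj : ∀ alpha beta, alpha < beta →
      {y | y ∈ cell P S b alpha ∧ ¬ (path P S alpha y ↔ b alpha)} ∩
        {y | y ∈ cell P S b beta ∧ ¬ (path P S beta y ↔ b beta)} = ∅ := by
    intro alpha beta hlt
    ext y
    simp only [Set.mem_inter_iff, Set.mem_ofPred_eq, Set.mem_empty_iff_false, iff_false]
    rintro ⟨⟨-, h⟩, ⟨h', -⟩⟩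
    exact h (h'.2 alpha hlt)
  have hmem : (∅ : Set Ordinal.{0}) ∈ restrictIdeal kappa I S :=
    ⟨Set.empty_subset _, by rw [Set.empty_inter]; exact hI.2.1⟩
  refine ⟨fun alpha => {y | y ∈ cell P S b alpha ∧ ¬ (path P S alpha y ↔ b alpha)},
    fun alpha halpha => ⟨fun y hy => hS hy.1.1, fun hmem => ?_⟩,
    fun alpha _ beta _ hne => ?_⟩
  · obtain ⟨hsub, hpos, hpos'⟩ := hP _ (fun y hy => hS hy.1) (hb alpha halpha)
    by_cases hba : b alpha
    · refine hpos' (hI.2.2.1 _ hmem.2 _ fun y hy => ⟨⟨hy.1, ?_⟩, hy.1.1⟩)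
      rw [path_iff_mem hy.1]
      exact fun h => hy.2 (h.2 hba)
    · refine hpos (hI.2.2.1 _ hmem.2 _ fun y hy => ⟨⟨hsub hy, ?_⟩, (hsub hy).1⟩)
      rw [path_iff_mem (hsub hy)]
      exact fun h => hba (h.1 hy)
  · rcases hne.lt_or_gt with hlt | hlt
    · rwa [hdisj alpha beta hlt]
    · rwa [Set.inter_comm, hdisj beta alpha hlt]

/-- Tarski. If `κ` is weakly compact and `I` is a `κ`-complete ideal
on `κ` such that every `I`-positive set splits into two disjoint `I`-positive sets, then
`I` is nowhere `κ`-saturated. -/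
theorem tarski_nowhere_saturated (kappa : Ordinal.{0}) (hwc : WeaklyCompact kappa)
    (I : Set (Set Ordinal.{0})) (hI : IsIdealOn kappa I) (hc : KComplete kappa I)
    (hsplit : ∀ S, S ⊆ Set.Iio kappa → S ∉ I →
      ∃ S0 S1, S0 ∉ I ∧ S1 ∉ I ∧ S0 ∩ S1 = ∅ ∧ S = S0 ∪ S1) :
    NowhereKappaSat kappa I := by
  intro S hS hSI
  have hsplit' : ∀ X, X ⊆ Set.Iio kappa → X ∉ I → ∃ Y, Y ⊆ X ∧ Y ∉ I ∧ X \ Y ∉ I := by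
    intro X hX hXI
    obtain ⟨S0, S1, h0, h1, hdisj, rfl⟩ := hsplit X hX hXI
    refine ⟨S0, Set.subset_union_left, h0, ?_⟩
    rwa [Set.union_sdiff_left, (Set.disjoint_iff_inter_eq_empty.2 hdisj).symm.sdiff_eq_left]
  choose! P hP using hsplit'
  by_cases hlong : ∃ x, ∀ alpha < kappa.card.ord, cell P S (path P S · x) alpha ∉ I
  · obtain ⟨x, hx⟩ := hlong
    exact not_isSatAt_of_branch hI hS hP _ hx
  push Not at hlong
  have hmin : ∀ x, ∃ alpha < kappa.card.ord, cell P S (path P S · x) alpha ∈ I ∧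
      ∀ beta < alpha, cell P S (path P S · x) beta ∉ I := by
    intro x
    obtain ⟨alpha, ⟨h1, h2⟩, h3⟩ := WellFounded.has_min (wellFounded_lt (α := Ordinal.{0}))
      {alpha | alpha < kappa.card.ord ∧ cell P S (path P S · x) alpha ∈ I} (hlong x)
    exact ⟨alpha, h1, h2, fun beta hb hmem => h3 beta ⟨hb.trans h1, hmem⟩ hb⟩
  choose len hlen hnull hpos using hmin
  let T : Ordinal.{0} → Set Ordinal.{0} := fun x => cell P S (path P S · x) (len x)
  have hT : ∀ x y, (∀ beta < len x, (path P S beta x ↔ path P S beta y)) → T x = T y := by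
    intro x y h
    have hc : ∀ alpha ≤ len x, cell P S (path P S · x) alpha = cell P S (path P S · y) alpha :=
      fun alpha ha => cell_congr fun beta hb => h beta (hb.trans_le ha)
    have hl : len x = len y := by
      refine le_antisymm (le_of_not_gt fun hlt => ?_) (le_of_not_gt fun hlt => ?_)
      · exact hpos x _ hlt (hc _ hlt.le ▸ hnull y)
      · exact hpos y _ hlt (hc _ le_rfl ▸ hnull x)
    exact (hc _ le_rfl).trans (congrArg _ hl)
  have hmany : Cardinal.lift.{1} kappa.card ≤ Cardinal.mk ↥(T '' S) := by
    by_contra! hlt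
    refine hSI (hI.2.2.1 _ (hc (T '' S) ?_ hlt) S fun x hx =>
      ⟨T x, ⟨x, hx, rfl⟩, hx, fun _ _ => Iff.rfl⟩)
    rintro _ ⟨x, -, rfl⟩
    exact hnull x
  have hmk : Cardinal.mk ↥(Set.Iio kappa.card.ord) ≤ Cardinal.mk ↥(T '' S) := by
    rwa [Cardinal.mk_Iio_ordinal, Cardinal.card_ord]
  obtain ⟨j⟩ := Cardinal.le_def _ _ |>.1 hmk
  have hr : ∀ xi : Ordinal.{0}, ∃ x, ∀ h : xi < kappa.card.ord,
      T x = (j ⟨xi, h⟩ : Set Ordinal.{0}) := by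
    intro xi
    by_cases h : xi < kappa.card.ord
    · obtain ⟨x, -, hx⟩ := (j ⟨xi, h⟩).2
      exact ⟨x, fun _ => hx⟩
    · exact ⟨0, fun h' => absurd h' h⟩
  choose r hr using hr
  have hrinj : ∀ xi < kappa.card.ord, ∀ eta < kappa.card.ord, T (r xi) = T (r eta) → xi = eta := by
    intro xi hxi eta heta h
    rw [hr xi hxi, hr eta heta] at h
    exact congrArg Subtype.val (j.injective (Subtype.ext h))
  let e : Ordinal.{0} → Ordinal.{0} → Prop := fun xi alpha => path P S alpha (r xi)
  obtain ⟨H, hH, hcard, c, hhom⟩ := hwc.exists_homogeneous (LexLT e)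
  have hinf := aleph0_le_card_of_weaklyCompact hwc
  have hst := hwc.exists_stable e hH hhom
  choose! g hg hstab using hst
  refine not_isSatAt_of_branch hI hS hP
    (fun beta => ∃ xi ∈ H, g beta ≤ xi ∧ e xi beta) fun alpha halpha => ?_
  have halpha' := (Cardinal.isSuccLimit_ord hinf).succ_lt halpha
  obtain ⟨zeta, hzeta, hbd⟩ := hwc.exists_bound halpha' g
    fun beta hb => hg beta (hb.trans halpha')
  obtain ⟨xi, hxi, hzx⟩ := exists_gt_of_mk_eq hinf hcard hzeta
  obtain ⟨eta, heta, hxe⟩ := exists_gt_of_mk_eq hinf hcard (hH hxi)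
  have hlt : alpha < len (r xi) := by
    by_contra! hle
    refine hxe.ne (hrinj xi (hH hxi) eta (hH heta) (hT _ _ fun beta hb => ?_))
    have hbs := Order.lt_succ_of_le (hb.le.trans hle)
    exact hstab beta (hbs.trans halpha') xi hxi eta heta ((hbd beta hbs).trans hzx.le)
      ((hbd beta hbs).trans (hzx.trans hxe).le)
  have hpos' := hpos (r xi) alpha hlt
  rwa [cell_congr fun beta hb => ?_] at hpos'
  have hbs := hb.trans (Order.lt_succ alpha)
  refine ⟨fun h => ⟨xi, hxi, (hbd beta hbs).trans hzx.le, h⟩, ?_⟩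
  rintro ⟨theta, htheta, hle, h⟩
  exact (hstab beta (hbs.trans halpha') theta htheta xi hxi hle
    ((hbd beta hbs).trans hzx.le)).1 h

end LCI
end

section
/- If κ is a weakly inaccessible cardinal and λ ≥ κ, then the nonstationary ideal NS_{κ,λ} on P_κλ is not strongly normal. -/
namespace LCI


/-- `P_κ λ` : the collection of subsets of `λ` of size less than `κ`. -/
def Pkl (kappa lam : Cardinal.{0}) : Set (Set Ordinal.{0}) :=
  {x | x ⊆ Set.Iio lam.ord ∧ Cardinal.mk ↥x < Cardinal.lift.{1} kappa}

/-- `C ⊆ P_κ λ` is club : `⊆`-cofinal and closed under unions of `⊆`-increasing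
chains of length less than `κ`. -/
def IsClubPkl (kappa lam : Cardinal.{0}) (C : Set (Set Ordinal.{0})) : Prop :=
  C ⊆ Pkl kappa lam ∧
  (∀ x ∈ Pkl kappa lam, ∃ y ∈ C, x ⊆ y) ∧
  ∀ D : Set (Set Ordinal.{0}), D ⊆ C → D.Nonempty → IsChain (· ⊆ ·) D →
    Cardinal.mk ↥D < Cardinal.lift.{1} kappa → ⋃₀ D ∈ C

/-- `κ_x = |x ∩ κ|`. -/
def kapOf (kappa : Cardinal.{0}) (x : Set Ordinal.{0}) : Cardinal.{1} :=
  Cardinal.mk ↥(x ∩ Set.Iio kappa.ord)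

/-- `x < y` iff `x ∈ P_{κ_y} y`. -/
def ltP (kappa : Cardinal.{0}) (x y : Set Ordinal.{0}) : Prop :=
  x ⊆ y ∧ Cardinal.mk ↥x < kapOf kappa y

/-- `X ⊆ P_κ λ` is stationary : it meets every club subset of `P_κ λ`. -/
def IsStationaryPkl (kappa lam : Cardinal.{0}) (X : Set (Set Ordinal.{0})) : Prop :=
  X ⊆ Pkl kappa lam ∧ ∀ C, IsClubPkl kappa lam C → (X ∩ C).Nonempty

/-- The nonstationary ideal `NS_{κ,λ}` on `P_κ λ`. -/
def NSkl (kappa lam : Cardinal.{0}) : Set (Set (Set Ordinal.{0})) :=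
  {X | X ⊆ Pkl kappa lam ∧ ∃ C, IsClubPkl kappa lam C ∧ X ∩ C = ∅}

/-- `I` is a strongly normal ideal on `P_κ λ` : every `<`-regressive function on an
`I`-positive set is constant on an `I`-positive subset. -/
def IsStronglyNormal (kappa lam : Cardinal.{0}) (I : Set (Set (Set Ordinal.{0}))) : Prop :=
  ∀ X, X ⊆ Pkl kappa lam → X ∉ I →
    ∀ f : Set Ordinal.{0} → Set Ordinal.{0}, (∀ x ∈ X, ltP kappa (f x) x) →
      ∃ Y, Y ⊆ X ∧ Y ∉ I ∧ ∀ x ∈ Y, ∀ y ∈ Y, f x = f y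

open Cardinal Set

theorem mk_sUnion_lt_lift {kappa : Cardinal.{0}} (hreg : kappa.IsRegular)
    {D : Set (Set Ordinal.{0})} (hD : #D < lift.{1} kappa)
    (h : ∀ x ∈ D, #x < lift.{1} kappa) : #(⋃₀ D) < lift.{1} kappa := by
  rw [sUnion_eq_biUnion]
  exact (card_biUnion_lt_iff_forall_of_isRegular hreg.lift hD).2 h

theorem sUnion_mem_Pkl {kappa lam : Cardinal.{0}} (hreg : kappa.IsRegular)
    {D : Set (Set Ordinal.{0})} (hsub : D ⊆ Pkl kappa lam) (hD : #D < lift.{1} kappa) :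
    ⋃₀ D ∈ Pkl kappa lam :=
  ⟨sUnion_subset fun _ hx => (hsub hx).1, mk_sUnion_lt_lift hreg hD fun _ hx => (hsub hx).2⟩

theorem insert_mem_Pkl {kappa lam : Cardinal.{0}} (hreg : kappa.IsRegular)
    {x : Set Ordinal.{0}} (hx : x ∈ Pkl kappa lam) {d : Ordinal.{0}} (hd : d < lam.ord) :
    insert d x ∈ Pkl kappa lam :=
  ⟨insert_subset hd hx.1, mk_insert_le.trans_lt <|
    add_lt_of_lt hreg.lift.aleph0_le hx.2 (one_lt_aleph0.trans_le hreg.lift.aleph0_le)⟩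

theorem mk_Iio_lt_lift {kappa : Cardinal.{0}} {o : Ordinal.{0}} (ho : o < kappa.ord) :
    #(Iio o) < lift.{1} kappa := by
  rw [mk_Iio_ordinal, lift_lt]
  exact lt_ord.1 ho

/-- A small set of ordinals below a regular cardinal `κ` is strictly bounded below `κ`. -/
theorem exists_strict_bound {kappa : Cardinal.{0}} (hreg : kappa.IsRegular)
    {s : Set Ordinal.{0}} (hs : #s < lift.{1} kappa) (hsub : s ⊆ Iio kappa.ord) :
    ∃ d < kappa.ord, ∀ b ∈ s, b < d := by
  by_contra! hcon
  have hlt : #(⋃ b ∈ s, Iic b) < lift.{1} kappa := by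
    refine (card_biUnion_lt_iff_forall_of_isRegular hreg.lift hs).2 fun b hb => ?_
    rw [← Order.Iio_succ]
    exact mk_Iio_lt_lift ((isSuccLimit_ord hreg.aleph0_le).succ_lt (hsub hb))
  have hle : #(Iio kappa.ord) ≤ #(⋃ b ∈ s, Iic b) := by
    refine mk_le_mk_of_subset fun d hd => ?_
    obtain ⟨b, hb, hdb⟩ := hcon d hd
    exact mem_biUnion hb hdb
  rw [mk_Iio_ordinal, card_ord] at hle
  exact hle.not_gt hlt

theorem isClubPkl_setOf_mem {kappa lam : Cardinal.{0}} (hreg : kappa.IsRegular)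
    {d : Ordinal.{0}} (hd : d < lam.ord) :
    IsClubPkl kappa lam {x | x ∈ Pkl kappa lam ∧ d ∈ x} := by
  refine ⟨fun x hx => hx.1, fun x hx => ⟨insert d x, ⟨insert_mem_Pkl hreg hx hd,
    mem_insert d x⟩, subset_insert d x⟩, fun D hD hne _ hcard =>
    ⟨sUnion_mem_Pkl hreg (fun x hx => (hD hx).1) hcard, ?_⟩⟩
  obtain ⟨y, hy⟩ := hne
  exact ⟨y, hy, (hD hy).2⟩

theorem exists_mem_of_notMem_NSkl {kappa lam : Cardinal.{0}} (hreg : kappa.IsRegular)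
    {Y : Set (Set Ordinal.{0})} (hsub : Y ⊆ Pkl kappa lam) (hY : Y ∉ NSkl kappa lam)
    {d : Ordinal.{0}} (hd : d < lam.ord) : ∃ x ∈ Y, d ∈ x := by
  by_contra! hcon
  refine hY ⟨hsub, _, isClubPkl_setOf_mem hreg hd, ?_⟩
  exact eq_empty_of_forall_notMem fun x hx => hcon x hx.1 hx.2.2

/-- The elements of `P_κ λ` whose trace on `κ` is uncountable and has a countable
cofinal subset. -/
def countableCofTrace (kappa lam : Cardinal.{0}) : Set (Set Ordinal.{0}) :=
  {x | x ∈ Pkl kappa lam ∧ ℵ₀ < kapOf kappa x ∧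
    ∃ a ⊆ x ∩ Iio kappa.ord, a.Countable ∧ ∀ b ∈ x ∩ Iio kappa.ord, ∃ g ∈ a, b ≤ g}

theorem IsClubPkl.exists_next {kappa lam : Cardinal.{0}} (hkl : kappa ≤ lam)
    (hreg : kappa.IsRegular) {C : Set (Set Ordinal.{0})} (hC : IsClubPkl kappa lam C) (c : C) :
    ∃ (d : C) (g : Ordinal.{0}), c.1 ⊆ d.1 ∧ g ∈ d.1 ∩ Iio kappa.ord ∧
      ∀ b ∈ c.1 ∩ Iio kappa.ord, b ≤ g := by
  have hc := hC.1 c.2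
  obtain ⟨g, hg, hbound⟩ := exists_strict_bound hreg (s := c.1 ∩ Iio kappa.ord)
    ((mk_le_mk_of_subset inter_subset_left).trans_lt hc.2) inter_subset_right
  obtain ⟨d, hd, hsub⟩ := hC.2.1 _ (insert_mem_Pkl hreg hc (hg.trans_le (ord_le_ord.2 hkl)))
  exact ⟨⟨d, hd⟩, g, (subset_insert g _).trans hsub, ⟨hsub (mem_insert g _), hg⟩,
    fun b hb => (hbound b hb).le⟩

theorem countableCofTrace_notMem_NSkl {kappa lam : Cardinal.{0}} (hkl : kappa ≤ lam)
    (hreg : kappa.IsRegular) (hone : Order.succ ℵ₀ < kappa) :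
    countableCofTrace kappa lam ∉ NSkl kappa lam := by
  rintro ⟨-, C, hC, hdisj⟩
  have hord : (Order.succ ℵ₀).ord < kappa.ord := ord_lt_ord.2 hone
  have hunc : ℵ₀ < lift.{1} kappa := by
    rw [← lift_aleph0.{1, 0}, lift_lt]
    exact (Order.lt_succ _).trans hone
  obtain ⟨c₀, hc₀, hsub₀⟩ := hC.2.1 (Iio (Order.succ ℵ₀).ord)
    ⟨Iio_subset_Iio (hord.le.trans (ord_le_ord.2 hkl)), mk_Iio_lt_lift hord⟩
  choose nxt gam hnxt hgam hbound using hC.exists_next hkl hreg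
  let c : ℕ → C := fun n => nxt^[n] ⟨c₀, hc₀⟩
  have hsucc (n : ℕ) : c (n + 1) = nxt (c n) := Function.iterate_succ_apply' _ _ _
  have hmono : Monotone fun n => (c n).1 := monotone_nat_of_le_succ fun n => by
    rw [hsucc]; exact hnxt (c n)
  have hcount : #(range fun n => (c n).1) < lift.{1} kappa :=
    (le_aleph0_iff_set_countable.2 (countable_range _)).trans_lt hunc
  have hU : ⋃₀ range (fun n => (c n).1) ∈ C :=
    hC.2.2 _ (range_subset_iff.2 fun n => (c n).2) (range_nonempty _) hmono.isChain_range hcount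
  refine eq_empty_iff_forall_notMem.1 hdisj _ ⟨⟨hC.1 hU, ?_, range fun n => gam (c n), ?_,
    countable_range _, ?_⟩, hU⟩
  · have hlt : ℵ₀ < #(Iio (Order.succ ℵ₀ : Cardinal.{0}).ord) := by
      rw [mk_Iio_ordinal, card_ord, ← lift_aleph0.{1, 0}, lift_lt]
      exact Order.lt_succ _
    exact hlt.trans_le <| mk_le_mk_of_subset fun b hb =>
      ⟨⟨c₀, ⟨0, rfl⟩, hsub₀ hb⟩, lt_trans hb hord⟩
  · rintro _ ⟨n, rfl⟩
    refine ⟨⟨_, ⟨n + 1, rfl⟩, ?_⟩, (hgam (c n)).2⟩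
    simp only [hsucc]
    exact (hgam (c n)).1
  · rintro b ⟨⟨_, ⟨n, rfl⟩, hb⟩, hbk⟩
    exact ⟨_, ⟨n, rfl⟩, hbound (c n) b ⟨hb, hbk⟩⟩

/-- Zwicker. If `κ` is weakly inaccessible and `λ ≥ κ`, then the
nonstationary ideal `NS_{κ,λ}` on `P_κ λ` is not strongly normal. -/
theorem ns_not_stronglyNormal (kappa lam : Cardinal.{0}) (hkl : kappa ≤ lam)
    (hreg : kappa.IsRegular) (hunc : Cardinal.aleph0 < kappa)
    (hlim : ∀ mu : Cardinal.{0}, mu < kappa → Order.succ mu < kappa) :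
    ¬ IsStronglyNormal kappa lam (NSkl kappa lam) := by
  intro hSN
  have hX : countableCofTrace kappa lam ⊆ Pkl kappa lam := fun x hx => hx.1
  choose! f hf hcount hcof using
    fun x (hx : x ∈ countableCofTrace kappa lam) => hx.2.2
  obtain ⟨Y, hYX, hY, hconst⟩ := hSN _ hX
    (countableCofTrace_notMem_NSkl hkl hreg (hlim _ hunc)) f fun x hx =>
      ⟨(hf x hx).trans inter_subset_left,
        (le_aleph0_iff_set_countable.2 (hcount x hx)).trans_lt hx.2.1⟩
  have hunbdd {d : Ordinal.{0}} (hd : d < kappa.ord) : ∃ x ∈ Y, d ∈ x :=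
    exists_mem_of_notMem_NSkl hreg (hYX.trans hX) hY (hd.trans_le (ord_le_ord.2 hkl))
  obtain ⟨x, hxY, -⟩ := hunbdd hreg.ord_pos
  have hx := hYX hxY
  obtain ⟨d, hd, hbound⟩ := exists_strict_bound hreg
    ((mk_le_mk_of_subset ((hf x hx).trans inter_subset_left)).trans_lt hx.1.2)
    ((hf x hx).trans inter_subset_right)
  obtain ⟨y, hyY, hdy⟩ := hunbdd hd
  obtain ⟨g, hg, hdg⟩ := hcof y (hYX hyY) d ⟨hdy, hd⟩
  rw [hconst y hyY x hxY] at hg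
  exact (hbound g hg).not_ge hdg

end LCI
end
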